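/- arXiv:math/0104287 — 3 statements merged into one kernel-verified Lean document; each statement's English description precedes it below -/
import Mathlib

section
/- The bilinear form B(f,g) = ∫ fg vol(θ) on Λ is invariant with respect to the Poisson bracket: B({f,g}, h) = B(f, {g,h}) for all f, g, h ∈ Λ. -/
/-!
We model the exterior (Grassmann) algebra `Λ` on `n` anticommuting generators over `ℂ`
concretely as the space of functions `Finset (Fin n) → ℂ` (coordinates with respect to the
monomial basis indexed by subsets of the generators, the generators being ordered by their
index).  For `2k` generators the first `k` indices are `ξ_1, …, ξ_k` and the last `k`
indices are `η_1, …, η_k`.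
-/

noncomputable section

/-- The Grassmann algebra on `n` generators: coordinates w.r.t. the basis of monomials
`θ_S = θ_{i_1}⋯θ_{i_r}` (`S = {i_1 < … < i_r}`). -/
abbrev Lam (n : ℕ) := Finset (Fin n) → ℂ

/-- Koszul sign of the multiplication `θ_S · θ_T` for disjoint `S`, `T`:
`(−1)^(number of pairs (s,t) ∈ S × T with t < s)`. -/
def ksign {n : ℕ} (S T : Finset (Fin n)) : ℂ :=
  (-1 : ℂ) ^ (∑ s ∈ S, (T.filter (fun t => t < s)).card)

/-- The (super)product on the Grassmann algebra `Lam n`: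
`θ_S · θ_T = ksign S T · θ_{S ∪ T}` for disjoint `S`, `T`, zero otherwise,
extended bilinearly. -/
def gmul {n : ℕ} (f g : Lam n) : Lam n :=
  fun U => ∑ S ∈ U.powerset, ksign S (U \ S) * f S * g (U \ S)

/-- The identity element `1` of the Grassmann algebra. -/
def oneLam {n : ℕ} : Lam n := fun S => if S = ∅ then 1 else 0

/-- `f` is homogeneous of `ℤ`-degree `d` (the parity `p f` is `d % 2`). -/
def IsHomog {n : ℕ} (d : ℕ) (f : Lam n) : Prop := ∀ S, f S ≠ 0 → S.card = d

/-- The odd derivation `∂_{θ_i}` of the Grassmann algebra: the unique odd derivation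
sending the generator `θ_i` to `1` and all other generators to `0`.  On monomials:
`∂_{θ_i} θ_T = (−1)^{#{j ∈ T : j < i}} θ_{T \ {i}}` if `i ∈ T`, and `0` otherwise. -/
def pd {n : ℕ} (i : Fin n) (f : Lam n) : Lam n :=
  fun S => if i ∈ S then 0 else ((-1 : ℂ) ^ (S.filter (fun j => j < i)).card) * f (insert i S)

/-- The operator multiplying each monomial of degree `d` by `−(−1)^d`; on a homogeneous
element `f` this is multiplication by `−(−1)^{p(f)}`.  It is used to extend the Poisson
bracket from homogeneous elements bilinearly. -/
def sgnF {n : ℕ} (f : Lam n) : Lam n :=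
  fun S => (-(-1 : ℂ) ^ S.card) * f S

/-- The index of the generator `ξ_j` among the `2k` generators. -/
def xIdx {k : ℕ} (j : Fin k) : Fin (2 * k) := ⟨j.1, by have := j.2; omega⟩

/-- The index of the generator `η_j` among the `2k` generators. -/
def yIdx {k : ℕ} (j : Fin k) : Fin (2 * k) := ⟨k + j.1, by have := j.2; omega⟩

/-- The Poisson bracket on `Lam (2k)`:
`{f,g} = −(−1)^{p(f)} ∑_{j=1}^{k} (∂_{ξ_j}f · ∂_{η_j}g + ∂_{η_j}f · ∂_{ξ_j}g)`
for homogeneous `f`, extended bilinearly (via `sgnF`).  `Lam (2k)` with this bracket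
is the Poisson superalgebra `po(0|2k)`. -/
def pbr {k : ℕ} (f g : Lam (2 * k)) : Lam (2 * k) :=
  ∑ j : Fin k,
    (gmul (pd (xIdx j) (sgnF f)) (pd (yIdx j) g) +
     gmul (pd (yIdx j) (sgnF f)) (pd (xIdx j) g))

/-- The Berezin integral `∫ f vol(θ)`: the coefficient of the top monomial
`ξ_1⋯ξ_k η_1⋯η_k`. -/
def berez {n : ℕ} (f : Lam n) : ℂ := f Finset.univ

/-- The bilinear form `B(f,g) = ∫ fg vol(θ)` on the Grassmann algebra. -/
def Bform {n : ℕ} (f g : Lam n) : ℂ := berez (gmul f g)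

end

noncomputable def sg {n : ℕ} (f : Lam n) : Lam n := fun S => ((-1 : ℂ) ^ S.card) * f S

theorem sgnF_eq {n : ℕ} (f : Lam n) : sgnF f = -(sg f) := by
  funext S; simp [sgnF, sg]

theorem ksign_union_left {n : ℕ} (S T U : Finset (Fin n)) (h : Disjoint S T) :
    ksign (S ∪ T) U = ksign S U * ksign T U := by
  unfold ksign
  rw [Finset.sum_union h, pow_add]

theorem ksign_union_right {n : ℕ} (S T U : Finset (Fin n)) (h : Disjoint T U) :
    ksign S (T ∪ U) = ksign S T * ksign S U := by
  unfold ksign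
  rw [← pow_add, ← Finset.sum_add_distrib]
  congr 1
  refine Finset.sum_congr rfl fun s _ => ?_
  rw [Finset.filter_union, Finset.card_union_of_disjoint]
  exact Finset.disjoint_filter_filter h

theorem ksign_singleton_left {n : ℕ} (i : Fin n) (T : Finset (Fin n)) :
    ksign {i} T = (-1 : ℂ) ^ (T.filter (fun j => j < i)).card := by
  simp [ksign]

theorem ksign_swap {n : ℕ} (i : Fin n) (S : Finset (Fin n)) (h : i ∉ S) :
    ksign S {i} = (-1 : ℂ) ^ S.card * ksign {i} S := by
  have h1 : ksign S {i} = (-1 : ℂ) ^ (S.filter (fun j => ¬ j < i)).card := by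
    unfold ksign
    congr 1
    rw [Finset.card_filter]
    refine Finset.sum_congr rfl fun s hs => ?_
    have : s ≠ i := fun e => h (e ▸ hs)
    rw [Finset.filter_singleton]
    by_cases hh : i < s
    · simp [hh, hh.le]
    · have : s < i := lt_of_le_of_ne (not_lt.mp hh) this
      simp [hh, this]
  rw [h1, ksign_singleton_left, ← Finset.card_filter_add_card_filter_not (s := S) (fun j => j < i),
    pow_add]
  have : ((-1 : ℂ) ^ (S.filter (fun j => j < i)).card) * ((-1 : ℂ) ^ (S.filter (fun j => j < i)).card) = 1 := by
    rw [← mul_pow]; simp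
  linear_combination (-(-1 : ℂ) ^ (S.filter (fun j => ¬ j < i)).card) * this

theorem ksign_sq {n : ℕ} (S T : Finset (Fin n)) : ksign S T * ksign S T = 1 := by
  unfold ksign
  rw [← mul_pow]; simp

theorem gmul_assoc' {n : ℕ} (f g h : Lam n) : gmul (gmul f g) h = gmul f (gmul g h) := by
  funext U
  simp only [gmul, Finset.mul_sum, Finset.sum_mul]
  rw [Finset.sum_sigma', Finset.sum_sigma']
  refine Finset.sum_bij' (fun x _ => ⟨x.2, x.1 \ x.2⟩) (fun x _ => ⟨x.1 ∪ x.2, x.1⟩) ?_ ?_ ?_ ?_ ?_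
  · rintro ⟨S, R⟩ hx
    simp only [Finset.mem_sigma, Finset.mem_powerset] at hx ⊢
    exact ⟨hx.2.trans hx.1, Finset.sdiff_subset_sdiff hx.1 le_rfl⟩
  · rintro ⟨R, T⟩ hx
    simp only [Finset.mem_sigma, Finset.mem_powerset] at hx ⊢
    exact ⟨Finset.union_subset hx.1 (hx.2.trans Finset.sdiff_subset), Finset.subset_union_left⟩
  · rintro ⟨S, R⟩ hx
    simp only [Finset.mem_sigma, Finset.mem_powerset] at hx
    simp [Finset.union_sdiff_of_subset hx.2]
  · rintro ⟨R, T⟩ hx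
    simp only [Finset.mem_sigma, Finset.mem_powerset] at hx
    have hd : Disjoint T R := (Finset.subset_sdiff.mp hx.2).2
    simp [Finset.union_sdiff_cancel_left hd.symm]
  · rintro ⟨S, R⟩ hx
    simp only [Finset.mem_sigma, Finset.mem_powerset] at hx
    obtain ⟨h1, h2⟩ := hx
    have e1 : (U \ R) \ (S \ R) = U \ S := by
      ext a
      have := @h1 a; have := @h2 a
      simp only [Finset.mem_sdiff]; tauto
    have e2 : U \ R = (S \ R) ∪ (U \ S) := by
      ext a
      have := @h1 a; have := @h2 a
      simp only [Finset.mem_sdiff, Finset.mem_union]; tauto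
    have d1 : Disjoint (S \ R) (U \ S) := by
      rw [Finset.disjoint_left]; intro a; simp only [Finset.mem_sdiff]; tauto
    have k1 : ksign S (U \ S) = ksign R (U \ S) * ksign (S \ R) (U \ S) := by
      conv_lhs => rw [← Finset.union_sdiff_of_subset h2]
      rw [Finset.union_sdiff_of_subset h2]
      conv_lhs => arg 1; rw [← Finset.union_sdiff_of_subset h2]
      exact ksign_union_left _ _ _ Finset.disjoint_sdiff
    have k2 : ksign R (U \ R) = ksign R (S \ R) * ksign R (U \ S) := by
      rw [e2]; exact ksign_union_right _ _ _ d1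
    dsimp only
    rw [e1, k1, k2]; ring

theorem pd_gmul {n : ℕ} (i : Fin n) (f g : Lam n) :
    pd i (gmul f g) = gmul (pd i f) g + gmul (sg f) (pd i g) := by
  funext U
  simp only [Pi.add_apply]
  by_cases hi : i ∈ U
  · obtain ⟨V, hV, rfl⟩ : ∃ V, i ∉ V ∧ insert i V = U :=
      ⟨U.erase i, Finset.notMem_erase i U, Finset.insert_erase hi⟩
    simp only [pd, hi, if_true, gmul]
    rw [Finset.sum_powerset_insert hV, Finset.sum_powerset_insert hV, ← Finset.sum_add_distrib,
      ← Finset.sum_add_distrib, ← Finset.sum_add_distrib]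
    symm
    apply Finset.sum_eq_zero
    intro S hS
    rw [Finset.mem_powerset] at hS
    have hiS : i ∉ S := fun h => hV (hS h)
    have hiVS : i ∉ V \ S := fun h => hV (Finset.mem_sdiff.mp h).1
    have e1 : insert i V \ S = insert i (V \ S) := Finset.insert_sdiff_of_notMem _ hiS
    have e2 : insert i V \ insert i S = V \ S := by
      ext a
      have : a = i → a ∉ V := fun e => e ▸ hV
      simp only [Finset.mem_sdiff, Finset.mem_insert]; tauto
    have k1 : ksign S (insert i (V \ S)) = ksign S {i} * ksign S (V \ S) := by
      rw [Finset.insert_eq]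
      exact ksign_union_right _ _ _ (Finset.disjoint_singleton_left.mpr hiVS)
    have k2 : ksign (insert i S) (V \ S) = ksign {i} (V \ S) * ksign S (V \ S) := by
      rw [Finset.insert_eq]
      exact ksign_union_left _ _ _ (Finset.disjoint_singleton_left.mpr hiS)
    rw [e1, e2, k1, k2, if_neg hiS, if_neg hiVS, if_pos (Finset.mem_insert_self i S),
      if_pos (Finset.mem_insert_self i (V \ S)), ← ksign_singleton_left, ← ksign_singleton_left,
      sg, sg, Finset.card_insert_of_notMem hiS, ksign_swap i S hiS]
    linear_combination ((-1 : ℂ) ^ S.card * ksign S (V \ S) * f (insert i S) *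
      g (insert i (V \ S))) * (ksign_sq {i} S - ksign_sq {i} (V \ S))
  · simp only [pd, hi, if_false, gmul]
    rw [Finset.sum_powerset_insert hi, add_comm, mul_add, Finset.mul_sum, Finset.mul_sum]
    congr 1
    · refine Finset.sum_congr rfl fun S hS => ?_
      rw [Finset.mem_powerset] at hS
      have hiS : i ∉ S := fun h => hi (hS h)
      have e1 : insert i U \ insert i S = U \ S := by
        ext a
        have : a = i → a ∉ U := fun e => e ▸ hi
        simp only [Finset.mem_sdiff, Finset.mem_insert]; tauto
      have k1 : ksign (insert i S) (U \ S) = ksign {i} (U \ S) * ksign S (U \ S) := by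
        rw [Finset.insert_eq]
        exact ksign_union_left _ _ _ (Finset.disjoint_singleton_left.mpr hiS)
      have k2 : ksign {i} U = ksign {i} S * ksign {i} (U \ S) := by
        rw [← ksign_union_right _ _ _ Finset.disjoint_sdiff, Finset.union_sdiff_of_subset hS]
      rw [e1, k1, if_neg hiS, ← ksign_singleton_left, ← ksign_singleton_left, k2]
      linear_combination (ksign {i} S * ksign S (U \ S) * f (insert i S) * g (U \ S)) *
        ksign_sq {i} (U \ S)
    · refine Finset.sum_congr rfl fun S hS => ?_
      rw [Finset.mem_powerset] at hS
      have hiS : i ∉ S := fun h => hi (hS h)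
      have hiUS : i ∉ U \ S := fun h => hi (Finset.mem_sdiff.mp h).1
      have e1 : insert i U \ S = insert i (U \ S) := Finset.insert_sdiff_of_notMem _ hiS
      have k1 : ksign S (insert i (U \ S)) = ksign S {i} * ksign S (U \ S) := by
        rw [Finset.insert_eq]
        exact ksign_union_right _ _ _ (Finset.disjoint_singleton_left.mpr hiUS)
      have k2 : ksign {i} U = ksign {i} S * ksign {i} (U \ S) := by
        rw [← ksign_union_right _ _ _ Finset.disjoint_sdiff, Finset.union_sdiff_of_subset hS]
      rw [e1, k1, if_neg hiUS, ← ksign_singleton_left, ← ksign_singleton_left, k2, sg,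
        ksign_swap i S hiS]
      linear_combination ((-1 : ℂ) ^ S.card * ksign {i} (U \ S) * ksign S (U \ S) * f S *
        g (insert i (U \ S))) * ksign_sq {i} S

theorem pd_anti {n : ℕ} (i j : Fin n) (hij : i ≠ j) (f : Lam n) :
    pd i (pd j f) + pd j (pd i f) = 0 := by
  funext S
  simp only [Pi.add_apply, Pi.zero_apply, pd]
  by_cases hi : i ∈ S
  · simp [hi]
  by_cases hj : j ∈ S
  · simp [hj]
  have h1 : j ∉ insert i S := by simp [hij.symm, hj]
  have h2 : i ∉ insert j S := by simp [hij, hi]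
  rw [if_neg hi, if_neg hj, if_neg h1, if_neg h2, Finset.insert_comm j i]
  simp only [← ksign_singleton_left]
  rw [Finset.insert_eq i S, Finset.insert_eq j S,
    ksign_union_right _ _ _ (Finset.disjoint_singleton_left.mpr hi),
    ksign_union_right _ _ _ (Finset.disjoint_singleton_left.mpr hj),
    ksign_swap i {j} (by simpa using hij)]
  simp only [Finset.card_singleton]
  ring

theorem pd_sg {n : ℕ} (i : Fin n) (f : Lam n) : sg (pd i f) = - pd i (sg f) := by
  funext S
  simp only [sg, pd, Pi.neg_apply]
  by_cases hi : i ∈ S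
  · simp [hi]
  · rw [if_neg hi, if_neg hi, Finset.card_insert_of_notMem hi]; ring

theorem sg_sg {n : ℕ} (f : Lam n) : sg (sg f) = f := by
  funext S
  simp only [sg]
  rw [← mul_assoc, ← mul_pow]; simp

theorem pd_neg {n : ℕ} (i : Fin n) (f : Lam n) : pd i (-f) = - pd i f := by
  funext S
  simp only [pd, Pi.neg_apply]
  split_ifs <;> simp

theorem berez_pd {n : ℕ} (i : Fin n) (f : Lam n) : berez (pd i f) = 0 := by
  simp [berez, pd]

theorem gmul_add_left {n : ℕ} (f g h : Lam n) : gmul (f + g) h = gmul f h + gmul g h := by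
  funext U
  simp only [gmul, Pi.add_apply, ← Finset.sum_add_distrib]
  exact Finset.sum_congr rfl fun _ _ => by ring

theorem gmul_add_right {n : ℕ} (f g h : Lam n) : gmul f (g + h) = gmul f g + gmul f h := by
  funext U
  simp only [gmul, Pi.add_apply, ← Finset.sum_add_distrib]
  exact Finset.sum_congr rfl fun _ _ => by ring

theorem gmul_neg_left {n : ℕ} (f h : Lam n) : gmul (-f) h = - gmul f h := by
  funext U
  simp only [gmul, Pi.neg_apply, ← Finset.sum_neg_distrib]
  exact Finset.sum_congr rfl fun _ _ => by ring

theorem gmul_neg_right {n : ℕ} (f h : Lam n) : gmul f (-h) = - gmul f h := by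
  funext U
  simp only [gmul, Pi.neg_apply, ← Finset.sum_neg_distrib]
  exact Finset.sum_congr rfl fun _ _ => by ring

theorem gmul_zero_left {n : ℕ} (h : Lam n) : gmul 0 h = 0 := by
  funext U; simp [gmul]

theorem gmul_zero_right {n : ℕ} (h : Lam n) : gmul h 0 = 0 := by
  funext U; simp [gmul]

theorem berez_add {n : ℕ} (f g : Lam n) : berez (f + g) = berez f + berez g := rfl

theorem berez_neg {n : ℕ} (f : Lam n) : berez (-f) = - berez f := rfl

theorem Bform_sum_left {n : ℕ} {ι : Type} (s : Finset ι) (F : ι → Lam n) (h : Lam n) :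
    Bform (∑ j ∈ s, F j) h = ∑ j ∈ s, Bform (F j) h := by
  classical
  induction s using Finset.induction_on with
  | empty => simp [Bform, gmul_zero_left, berez]
  | insert a s ha ih =>
    rw [Finset.sum_insert ha, Finset.sum_insert ha, ← ih]
    simp only [Bform, gmul_add_left, berez_add]

theorem Bform_sum_right {n : ℕ} {ι : Type} (s : Finset ι) (F : ι → Lam n) (h : Lam n) :
    Bform h (∑ j ∈ s, F j) = ∑ j ∈ s, Bform h (F j) := by
  classical
  induction s using Finset.induction_on with
  | empty => simp [Bform, gmul_zero_right, berez]
  | insert a s ha ih =>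
    rw [Finset.sum_insert ha, Finset.sum_insert ha, ← ih]
    simp only [Bform, gmul_add_right, berez_add]

theorem key {n : ℕ} (a b : Fin n) (f g h : Lam n) :
    berez (gmul (pd b (sg f)) (gmul (pd a g) h)) + berez (gmul f (gmul (pd b (pd a g)) h))
      - berez (gmul f (gmul (pd a (sg g)) (pd b h))) = 0 := by
  have := berez_pd b (gmul (sg f) (gmul (pd a g) h))
  rw [pd_gmul, pd_gmul, sg_sg, pd_sg, gmul_neg_left, gmul_add_right, gmul_neg_right,
    berez_add, berez_add, berez_neg] at this
  linear_combination this

theorem xy_ne {k : ℕ} (j : Fin k) : xIdx j ≠ yIdx j := by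
  intro h
  have := congrArg Fin.val h
  have := j.2
  simp only [xIdx, yIdx] at *
  omega

/-- The bilinear form `B(f,g) = ∫ fg vol(θ)` on `Λ` is invariant with
respect to the Poisson bracket: `B({f,g}, h) = B(f, {g,h})` for all `f, g, h ∈ Λ`. -/
theorem Bform_invariant (k : ℕ) (hk : 1 ≤ k) (f g h : Lam (2 * k)) :
    Bform (pbr f g) h = Bform f (pbr g h) := by
  unfold pbr
  rw [Bform_sum_left, Bform_sum_right]
  refine Finset.sum_congr rfl fun j _ => ?_
  have h1 := key (xIdx j) (yIdx j) f g h
  have h2 := key (yIdx j) (xIdx j) f g h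
  have h3 : berez (gmul f (gmul (pd (xIdx j) (pd (yIdx j) g)) h))
      + berez (gmul f (gmul (pd (yIdx j) (pd (xIdx j) g)) h)) = 0 := by
    rw [← berez_add, ← gmul_add_right, ← gmul_add_left, pd_anti _ _ (xy_ne j), gmul_zero_left,
      gmul_zero_right]
    rfl
  simp only [Bform, sgnF_eq, pd_neg, gmul_neg_left, gmul_neg_right, gmul_add_left, gmul_add_right,
    berez_add, berez_neg, gmul_assoc']
  linear_combination h3 - h1 - h2
end

section
/- Let W = { f ∈ Λ : ∫ f vol(θ) = 0 } be the space of traceless elements. The radical of the restriction of B to W is exactly ℂ·1; that is, f ∈ W satisfies B(f,g) = 0 for all g ∈ W if and only if f ∈ ℂ·1. Hence B induces a nondegenerate bilinear form on the quotient W/ℂ·1 (the form on the special Hamiltonian superalgebra sh(0|2k)). -/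
/-- Let `W = { f ∈ Λ : ∫ f vol(θ) = 0 }` be the traceless elements.  The
radical of the restriction of `B` to `W` is exactly `ℂ·1`: for `f ∈ W`, `B(f,g) = 0`
for all `g ∈ W` iff `f ∈ ℂ·1`.  (Hence `B` induces a nondegenerate form on `W/ℂ·1`,
the form on `sh(0|2k)`.) -/
theorem Bform_radical_on_traceless (k : ℕ) (hk : 1 ≤ k) (f : Lam (2 * k))
    (hf : berez f = 0) :
    (∀ g : Lam (2 * k), berez g = 0 → Bform f g = 0) ↔ (∃ c : ℂ, f = c • oneLam) := by
  constructor
  · intro h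
    refine ⟨f ∅, ?_⟩
    funext S
    by_cases hS : S = ∅
    · subst hS; simp [oneLam]
    · have h1 := h (Pi.single Sᶜ 1) (by
        have : (Finset.univ : Finset (Fin (2*k))) ≠ Sᶜ := by
          intro e
          apply hS
          rw [← compl_compl S, ← e]; simp
        simp [berez, Pi.single_apply, this])
      unfold Bform berez gmul at h1
      rw [Finset.sum_eq_single S] at h1
      · have hk : ksign S (Finset.univ \ S) ≠ 0 := by
          unfold ksign; exact pow_ne_zero _ (by norm_num)
        rw [← Finset.compl_eq_univ_sdiff] at h1 hk
        simp [hk] at h1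
        simp [oneLam, hS, h1]
      · intro T _ hT
        rw [← Finset.compl_eq_univ_sdiff]
        have : Tᶜ ≠ Sᶜ := fun e => hT (compl_injective e)
        simp [Pi.single_apply, this]
      · intro hn; simp at hn
  · rintro ⟨c, rfl⟩ g hg
    unfold Bform berez gmul
    apply Finset.sum_eq_zero
    intro S _
    by_cases hS : S = ∅
    · subst hS
      have : g Finset.univ = 0 := hg
      simp [this]
    · simp [oneLam, hS]
end

section
/- The map c(t^m ⊗ f, t^n ⊗ g) = δ_{m+n,0} · m · ∫ fg vol(θ), extended bilinearly to the loop algebra L = ℂ[t,t^{−1}] ⊗ Λ, is a 2-cocycle on the loop Poisson superalgebra po(0|2k)^{(1)}: for homogeneous x, y, z ∈ L (parity taken from the Λ-factor) one has c(x,y) = −(−1)^{p(x)p(y)} c(y,x) and c({x,y},z) + (−1)^{p(x)(p(y)+p(z))} c({y,z},x) + (−1)^{p(z)(p(x)+p(y))} c({z,x},y) = 0. (This cocycle defines the nontrivial central extension of po(0|2k)^{(1)} used in its Kac–Moody version.) -/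
/-!
The Laurent/loop level: `A = ℂ[t,t⁻¹] ⊗ Λ`, modelled as finitely supported functions
`ℤ →₀ Lam n` (the value at `m` is the coefficient of `t^m`).
-/

noncomputable section

/-- `ℂ[t,t⁻¹] ⊗ Λ`: Laurent polynomials in the even variable `t` with coefficients
in the Grassmann algebra `Lam n`. -/
abbrev LoopLam (n : ℕ) := ℤ →₀ Lam n

/-- The product on `LoopLam n`: `(t^m ⊗ x)(t^p ⊗ y) = t^{m+p} ⊗ (x·y)`. -/
def tmul {n : ℕ} (f g : LoopLam n) : LoopLam n :=
  f.sum fun m x => g.sum fun p y => Finsupp.single (m + p) (gmul x y)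

/-- Differentiation `∂_t` in the even variable `t`. -/
def dt {n : ℕ} (f : LoopLam n) : LoopLam n :=
  f.sum fun m x => Finsupp.single (m - 1) ((m : ℂ) • x)

/-- The Euler operator `E`: on `t^a ⊗ w` with `w` of Grassmann degree `d` it acts
as multiplication by `d`. -/
def euler {n : ℕ} (f : LoopLam n) : LoopLam n :=
  f.sum fun m x => Finsupp.single m (fun S => (S.card : ℂ) * x S)

/-- The Poisson bracket extended `ℂ[t,t⁻¹]`-bilinearly to `LoopLam (2k)`. -/
def pbrL {k : ℕ} (f g : LoopLam (2 * k)) : LoopLam (2 * k) :=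
  f.sum fun m x => g.sum fun p y => Finsupp.single (m + p) (pbr x y)

/-- The contact bracket
`{f,g}_{k.b.} = (2−E)(f)·∂_t(g) − ∂_t(f)·(2−E)(g) − {f,g}_{P.b.}` on `LoopLam (2k)`;
this is the Lie superalgebra `k^L(1|2k)` in its generating-functions realization. -/
def kbr {k : ℕ} (f g : LoopLam (2 * k)) : LoopLam (2 * k) :=
  tmul ((2 : ℂ) • f - euler f) (dt g) - tmul (dt f) ((2 : ℂ) • g - euler g) - pbrL f g

/-- `f ∈ LoopLam n` is homogeneous of Grassmann degree `d` (its parity is `d % 2`). -/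
def IsHomogL {n : ℕ} (d : ℕ) (f : LoopLam n) : Prop :=
  ∀ (m : ℤ) (S : Finset (Fin n)), f m S ≠ 0 → S.card = d

end

noncomputable section

/-- `Res f`: the coefficient of `(1/t)·θ_1⋯θ_n` (the top Grassmann monomial over `t^{-1}`)
in the expansion of `f` in the monomial basis. -/
def ResL {n : ℕ} (f : LoopLam n) : ℂ := f (-1) Finset.univ

/-- The bilinear form `B(f,g) = Res (fg)` on `ℂ[t,t⁻¹] ⊗ Λ`. -/
def BRes {n : ℕ} (f g : LoopLam n) : ℂ := ResL (tmul f g)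

/-- The 2-cocycle `c(t^m ⊗ f, t^n ⊗ g) = δ_{m+n,0} · m · ∫ fg vol(θ)` on the loop
Poisson superalgebra, extended bilinearly. -/
def cocyc {n : ℕ} (f g : LoopLam n) : ℂ :=
  f.sum fun m x => (m : ℂ) * berez (gmul x (g (-m)))

/-- The bilinear form `B⁽¹⁾(t^m ⊗ f, t^n ⊗ g) = δ_{m+n,0} · ∫ fg vol(θ)` on the loop
algebra, extended bilinearly. -/
def Bloop {n : ℕ} (f g : LoopLam n) : ℂ :=
  f.sum fun m x => berez (gmul x (g (-m)))

end


namespace CocAux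

open Finset

def ee {n : ℕ} (i : Fin n) (S : Finset (Fin n)) : ℂ :=
  (-1 : ℂ) ^ (S.filter (fun j => j < i)).card

def IsPar {n : ℕ} (d : ℕ) (f : Lam n) : Prop :=
  ∀ S, f S ≠ 0 → (-1 : ℂ) ^ S.card = (-1 : ℂ) ^ d

lemma neg_sq (m : ℕ) : (-1 : ℂ) ^ m * (-1 : ℂ) ^ m = 1 := by
  rw [← mul_pow]; simp

lemma ee_sq {n : ℕ} (i : Fin n) (S : Finset (Fin n)) : ee i S * ee i S = 1 := neg_sq _

lemma ksign_insert_left {n : ℕ} (i : Fin n) (S T : Finset (Fin n)) (hS : i ∉ S) :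
    ksign (insert i S) T = ee i T * ksign S T := by
  unfold ksign ee
  rw [Finset.sum_insert hS, pow_add]

lemma ksign_union_left {n : ℕ} (S S' T : Finset (Fin n)) (h : Disjoint S S') :
    ksign (S ∪ S') T = ksign S T * ksign S' T := by
  unfold ksign
  rw [Finset.sum_union h, pow_add]

lemma ksign_union_right {n : ℕ} (S T T' : Finset (Fin n)) (h : Disjoint T T') :
    ksign S (T ∪ T') = ksign S T * ksign S T' := by
  unfold ksign
  rw [← pow_add, ← Finset.sum_add_distrib]
  congr 1
  refine Finset.sum_congr rfl fun s _ => ?_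
  rw [Finset.filter_union, Finset.card_union_of_disjoint]
  exact Finset.disjoint_filter_filter h

lemma ksign_comm {n : ℕ} (S T : Finset (Fin n)) (h : Disjoint S T) :
    ksign S T = (-1 : ℂ) ^ (S.card * T.card) * ksign T S := by
  have key : (∑ s ∈ S, (T.filter (fun t => t < s)).card)
      + (∑ t ∈ T, (S.filter (fun s => s < t)).card) = S.card * T.card := by
    have h2 : (∑ t ∈ T, (S.filter (fun s => s < t)).card)
        = ∑ s ∈ S, (T.filter (fun t => s < t)).card := by
      simp only [Finset.card_filter]
      exact Finset.sum_comm
    rw [h2, ← Finset.sum_add_distrib, ← smul_eq_mul, ← Finset.sum_const]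
    refine Finset.sum_congr rfl fun s hs => ?_
    rw [← Finset.card_filter_add_card_filter_not (s := T) (fun t => t < s)]
    congr 2
    refine Finset.filter_congr fun t ht => ?_
    have : s ≠ t := fun e => (Finset.disjoint_left.mp h hs) (e ▸ ht)
    constructor
    · intro h1; exact not_lt.mpr h1.le
    · intro h1; exact lt_of_le_of_ne (not_lt.mp h1) this
  unfold ksign
  rw [← key, pow_add, mul_assoc, neg_sq, mul_one]

lemma ksign_single {n : ℕ} (i : Fin n) (T : Finset (Fin n)) : ksign {i} T = ee i T := by
  simp [ksign, ee]

lemma ksign_insert_right {n : ℕ} (i : Fin n) (S T : Finset (Fin n)) (hS : i ∉ S) (hT : i ∉ T) :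
    ksign S (insert i T) = (-1 : ℂ) ^ S.card * ee i S * ksign S T := by
  rw [Finset.insert_eq, ksign_union_right _ _ _ (by simpa using hT),
    ksign_comm S {i} (by simpa using hS), ksign_single]
  simp

lemma gmul_add_left {n : ℕ} (f g h : Lam n) : gmul (f + g) h = gmul f h + gmul g h := by
  funext U; simp [gmul, mul_add, add_mul, Finset.sum_add_distrib]
lemma gmul_add_right {n : ℕ} (f g h : Lam n) : gmul f (g + h) = gmul f g + gmul f h := by
  funext U; simp [gmul, mul_add, Finset.sum_add_distrib]
lemma gmul_smul_left {n : ℕ} (c : ℂ) (f g : Lam n) : gmul (c • f) g = c • gmul f g := by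
  funext U; simp only [gmul, Pi.smul_apply, smul_eq_mul, Finset.mul_sum]
  exact Finset.sum_congr rfl fun _ _ => by ring
lemma gmul_smul_right {n : ℕ} (c : ℂ) (f g : Lam n) : gmul f (c • g) = c • gmul f g := by
  funext U; simp only [gmul, Pi.smul_apply, smul_eq_mul, Finset.mul_sum]
  exact Finset.sum_congr rfl fun _ _ => by ring
lemma gmul_zero_left {n : ℕ} (g : Lam n) : gmul 0 g = 0 := by
  funext U; simp [gmul]
lemma gmul_zero_right {n : ℕ} (g : Lam n) : gmul g 0 = 0 := by
  funext U; simp [gmul]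
lemma gmul_sum_left {n : ℕ} {ι : Type*} (s : Finset ι) (F : ι → Lam n) (h : Lam n) :
    gmul (∑ j ∈ s, F j) h = ∑ j ∈ s, gmul (F j) h := by
  classical
  induction s using Finset.induction_on with
  | empty => simp [gmul_zero_left]
  | insert a s ha ih => rw [Finset.sum_insert ha, Finset.sum_insert ha, gmul_add_left, ih]
lemma gmul_sum_right {n : ℕ} {ι : Type*} (s : Finset ι) (F : ι → Lam n) (h : Lam n) :
    gmul h (∑ j ∈ s, F j) = ∑ j ∈ s, gmul h (F j) := by
  classical
  induction s using Finset.induction_on with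
  | empty => simp [gmul_zero_right]
  | insert a s ha ih => rw [Finset.sum_insert ha, Finset.sum_insert ha, gmul_add_right, ih]

lemma pd_smul {n : ℕ} (i : Fin n) (c : ℂ) (f : Lam n) : pd i (c • f) = c • pd i f := by
  funext S; simp only [pd, Pi.smul_apply, smul_eq_mul]; split_ifs <;> ring
lemma pd_zero {n : ℕ} (i : Fin n) : pd i (0 : Lam n) = 0 := by
  funext S; simp [pd]

lemma gmul_assoc {n : ℕ} (f g h : Lam n) : gmul (gmul f g) h = gmul f (gmul g h) := by
  funext U
  simp only [gmul, Finset.mul_sum, Finset.sum_mul]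
  rw [Finset.sum_sigma', Finset.sum_sigma']
  refine Finset.sum_bij' (fun p _ => ⟨p.2, p.1 \ p.2⟩) (fun p _ => ⟨p.1 ∪ p.2, p.1⟩) ?_ ?_ ?_ ?_ ?_
  · rintro ⟨S, R⟩ hp
    simp only [Finset.mem_sigma, Finset.mem_powerset] at hp ⊢
    exact ⟨hp.2.trans hp.1, Finset.sdiff_subset_sdiff hp.1 le_rfl⟩
  · rintro ⟨S, R⟩ hp
    simp only [Finset.mem_sigma, Finset.mem_powerset] at hp ⊢
    exact ⟨Finset.union_subset hp.1 (hp.2.trans Finset.sdiff_subset), Finset.subset_union_left⟩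
  · rintro ⟨S, R⟩ hp
    simp only [Finset.mem_sigma, Finset.mem_powerset] at hp
    simp [Finset.union_sdiff_of_subset hp.2]
  · rintro ⟨S, R⟩ hp
    simp only [Finset.mem_sigma, Finset.mem_powerset] at hp
    have : Disjoint S R := (Finset.disjoint_sdiff.mono_right hp.2)
    simp [Finset.union_sdiff_cancel_left this]
  · rintro ⟨S, R⟩ hp
    simp only [Finset.mem_sigma, Finset.mem_powerset] at hp
    obtain ⟨h1, h2⟩ := hp
    dsimp only
    have e1 : (U \ R) \ (S \ R) = U \ S := by
      ext a; simp only [Finset.mem_sdiff]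
      have := @h2 a
      tauto
    have e2 : U \ R = (S \ R) ∪ (U \ S) := by
      ext a; simp only [Finset.mem_sdiff, Finset.mem_union]
      have := @h2 a
      have := @h1 a
      tauto
    have d1 : Disjoint (S \ R) (U \ S) :=
      Finset.disjoint_sdiff.mono_left Finset.sdiff_subset
    have e3 : ksign S (U \ S) = ksign R (U \ S) * ksign (S \ R) (U \ S) := by
      rw [← ksign_union_left _ _ _ Finset.disjoint_sdiff, Finset.union_sdiff_of_subset h2]
    rw [e1, e3]
    rw [e2, ksign_union_right _ _ _ d1]
    ring

lemma gmul_comm {n : ℕ} {a b : ℕ} (f g : Lam n) (hf : IsPar a f) (hg : IsPar b g) :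
    gmul f g = (-1 : ℂ) ^ (a * b) • gmul g f := by
  funext U
  simp only [gmul, Pi.smul_apply, smul_eq_mul, Finset.mul_sum]
  refine Finset.sum_bij' (fun S _ => U \ S) (fun S _ => U \ S) ?_ ?_ ?_ ?_ ?_
  · intro S _; simp
  · intro S _; simp
  · intro S hS; simpa using Finset.mem_powerset.mp hS
  · intro S hS; simpa using Finset.mem_powerset.mp hS
  · intro S hS
    have hS := Finset.mem_powerset.mp hS
    rw [Finset.sdiff_sdiff_eq_self hS]
    by_cases h1 : f S = 0
    · simp [h1]
    by_cases h2 : g (U \ S) = 0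
    · simp [h2]
    rw [ksign_comm _ _ Finset.disjoint_sdiff]
    have : (-1 : ℂ) ^ (S.card * (U \ S).card) = (-1 : ℂ) ^ (a * b) := by
      rw [pow_mul, hf _ h1, ← pow_mul, mul_comm a, pow_mul, hg _ h2, ← pow_mul, mul_comm]
    rw [this]; ring

lemma par_pd {n : ℕ} {a : ℕ} (i : Fin n) (f : Lam n) (hf : IsPar a f) :
    IsPar (a + 1) (pd i f) := by
  intro S hS
  unfold pd at hS
  split_ifs at hS with h
  · exact absurd rfl hS
  · have := hf _ (right_ne_zero_of_mul hS)
    rw [Finset.card_insert_of_notMem h] at this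
    rw [pow_succ, ← this]; ring

lemma par_gmul {n : ℕ} {a b : ℕ} (f g : Lam n) (hf : IsPar a f) (hg : IsPar b g) :
    IsPar (a + b) (gmul f g) := by
  intro U hU
  obtain ⟨S, hS, h⟩ := Finset.exists_ne_zero_of_sum_ne_zero hU
  have hS := Finset.mem_powerset.mp hS
  rw [pow_add, ← hf S (right_ne_zero_of_mul (left_ne_zero_of_mul h)),
    ← hg _ (right_ne_zero_of_mul h), ← pow_add, add_comm, Finset.card_sdiff_add_card_eq_card hS]

lemma par_smul {n : ℕ} {a : ℕ} (c : ℂ) (f : Lam n) (hf : IsPar a f) : IsPar a (c • f) := by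
  intro S hS
  exact hf S (right_ne_zero_of_mul hS)

lemma par_add {n : ℕ} {a : ℕ} (f g : Lam n) (hf : IsPar a f) (hg : IsPar a g) :
    IsPar a (f + g) := by
  intro S hS
  by_cases h : f S = 0
  · refine hg S fun h' => hS ?_
    simp [h, h']
  · exact hf S h

lemma par_sum {n : ℕ} {a : ℕ} {ι : Type*} (s : Finset ι) (F : ι → Lam n)
    (h : ∀ j, IsPar a (F j)) : IsPar a (∑ j ∈ s, F j) := by
  intro S hS
  rw [Finset.sum_apply] at hS
  obtain ⟨j, _, hj⟩ := Finset.exists_ne_zero_of_sum_ne_zero hS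
  exact h j S hj

lemma leibniz {n : ℕ} {a : ℕ} (i : Fin n) (f g : Lam n) (hf : IsPar a f) :
    pd i (gmul f g) = gmul (pd i f) g + (-1 : ℂ) ^ a • gmul f (pd i g) := by
  have hsg : ∀ S, (-1 : ℂ) ^ a * f S = (-1 : ℂ) ^ S.card * f S := by
    intro S
    by_cases h : f S = 0
    · simp [h]
    · rw [hf S h]
  funext U
  by_cases hi : i ∈ U
  · obtain ⟨V, hV, rfl⟩ : ∃ V, i ∉ V ∧ U = insert i V :=
      ⟨U.erase i, Finset.notMem_erase _ _, (Finset.insert_erase hi).symm⟩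
    simp only [Pi.add_apply, Pi.smul_apply, smul_eq_mul, gmul]
    rw [Finset.sum_powerset_insert hV, Finset.sum_powerset_insert hV]
    have hl : pd i (gmul f g) (insert i V) = 0 := by simp [pd]
    rw [hl, mul_add, Finset.mul_sum, Finset.mul_sum, ← Finset.sum_add_distrib,
      ← Finset.sum_add_distrib, ← Finset.sum_add_distrib]
    symm
    refine Finset.sum_eq_zero fun S hS => ?_
    have hS := Finset.mem_powerset.mp hS
    have hiS : i ∉ S := fun h => hV (hS h)
    have hiT : i ∉ V \ S := fun h => hV (Finset.mem_sdiff.mp h).1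
    have q1 : insert i V \ S = insert i (V \ S) := Finset.insert_sdiff_of_notMem _ hiS
    have q2 : insert i V \ insert i S = V \ S := by
      ext a; simp only [Finset.mem_sdiff, Finset.mem_insert]
      by_cases h : a = i
      · subst h; simp [hV]
      · simp [h]
    have p1 : pd i f (insert i S) = 0 := by simp [pd]
    have p2 : pd i g (insert i (V \ S)) = 0 := by simp [pd]
    have p3 : pd i f S = ee i S * f (insert i S) := by simp [pd, hiS, ee]
    have p4 : pd i g (V \ S) = ee i (V \ S) * g (insert i (V \ S)) := by
      rw [pd, if_neg hiT]; rfl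
    rw [q1, q2, p1, p2, p3, p4, ksign_insert_right i S _ hiS hiT, ksign_insert_left i S _ hiS]
    have s1 := ee_sq i S
    have s2 := ee_sq i (V \ S)
    have s3 := hsg (insert i S)
    rw [Finset.card_insert_of_notMem hiS] at s3
    linear_combination (-1 : ℂ) ^ S.card * ksign S (V \ S) * f (insert i S)
        * g (insert i (V \ S)) * (s1 - s2)
      + ee i (V \ S) * ee i (V \ S) * ksign S (V \ S) * g (insert i (V \ S)) * s3
  · have hl : pd i (gmul f g) U = ee i U * gmul f g (insert i U) := by simp [pd, hi, ee]
    rw [hl]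
    simp only [Pi.add_apply, Pi.smul_apply, smul_eq_mul, gmul]
    rw [Finset.sum_powerset_insert hi, mul_add, Finset.mul_sum, Finset.mul_sum, Finset.mul_sum,
      ← Finset.sum_add_distrib, ← Finset.sum_add_distrib]
    refine Finset.sum_congr rfl fun S hS => ?_
    have hS := Finset.mem_powerset.mp hS
    have hiS : i ∉ S := fun h => hi (hS h)
    have hiT : i ∉ U \ S := fun h => hi (Finset.mem_sdiff.mp h).1
    have q1 : insert i U \ S = insert i (U \ S) := Finset.insert_sdiff_of_notMem _ hiS
    have q2 : insert i U \ insert i S = U \ S := by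
      ext a; simp only [Finset.mem_sdiff, Finset.mem_insert]
      by_cases h : a = i
      · subst h; simp [hi]
      · simp [h]
    have p3 : pd i f S = ee i S * f (insert i S) := by simp [pd, hiS, ee]
    have p4 : pd i g (U \ S) = ee i (U \ S) * g (insert i (U \ S)) := by
      rw [pd, if_neg hiT]; rfl
    have e3 : ee i U = ee i S * ee i (U \ S) := by
      rw [← ksign_single, ← ksign_single, ← ksign_single,
        ← ksign_union_right _ _ _ Finset.disjoint_sdiff, Finset.union_sdiff_of_subset hS]
    rw [q1, q2, p3, p4, ksign_insert_right i S _ hiS hiT, ksign_insert_left i S _ hiS, e3]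
    have s1 := ee_sq i S
    have s2 := ee_sq i (U \ S)
    have s3 := hsg S
    linear_combination (-1 : ℂ) ^ S.card * ksign S (U \ S) * f S
        * g (insert i (U \ S)) * ee i (U \ S) * s1
      + ee i S * ksign S (U \ S) * f (insert i S) * g (U \ S) * s2
      - ksign S (U \ S) * ee i (U \ S) * g (insert i (U \ S)) * s3

lemma ee_insert {n : ℕ} (i j : Fin n) (S : Finset (Fin n)) (hi : i ∉ S) :
    ee j (insert i S) = (if i < j then -1 else 1) * ee j S := by
  unfold ee
  rw [Finset.filter_insert]
  split_ifs with h
  · rw [Finset.card_insert_of_notMem (by simp [hi])]; ring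
  · simp

lemma pd_anti {n : ℕ} (i j : Fin n) (hij : i ≠ j) (f : Lam n) :
    pd i (pd j f) = (-1 : ℂ) • pd j (pd i f) := by
  funext S
  have e1 := fun h => ee_insert i j S h
  have e2 := fun h => ee_insert j i S h
  unfold ee at e1 e2
  simp only [pd, Pi.smul_apply, smul_eq_mul, Finset.mem_insert, hij, hij.symm, false_or]
  by_cases hi : i ∈ S
  · simp [hi]
  by_cases hj : j ∈ S
  · simp [hj]
  simp only [hi, hj, if_false, e1 hi, e2 hj, Finset.insert_comm i j]
  rcases lt_or_gt_of_ne hij with h | h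
  · simp only [h, not_lt.mpr h.le, if_true, if_false]; ring
  · simp only [h, not_lt.mpr h.le, if_true, if_false]; ring

lemma ibp {n : ℕ} {a b : ℕ} (i j : Fin n) (f g h : Lam n) (hf : IsPar a f) (hg : IsPar b g) :
    berez (gmul (gmul (pd i f) (pd j g)) h) =
      (-1 : ℂ) ^ (a + b) * berez (gmul f (gmul (pd j g) (pd i h)))
      - (-1 : ℂ) ^ a * berez (gmul f (gmul (pd i (pd j g)) h)) := by
  have h0 : berez (pd i (gmul f (gmul (pd j g) h))) = 0 := by simp [berez, pd]
  rw [leibniz i f _ hf, leibniz i _ h (par_pd j g hg), gmul_add_right, gmul_smul_right,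
    ← gmul_assoc] at h0
  simp only [berez, Pi.add_apply, Pi.smul_apply, smul_eq_mul] at h0 ⊢
  linear_combination h0

lemma sgnF_par {n : ℕ} {a : ℕ} (f : Lam n) (hf : IsPar a f) :
    sgnF f = (-(-1 : ℂ) ^ a) • f := by
  funext S
  simp only [sgnF, Pi.smul_apply, smul_eq_mul]
  by_cases h : f S = 0
  · simp [h]
  · rw [hf S h]

lemma pbr_par {k : ℕ} {a : ℕ} (f g : Lam (2 * k)) (hf : IsPar a f) :
    pbr f g = (-(-1 : ℂ) ^ a) • ∑ j : Fin k,
      (gmul (pd (xIdx j) f) (pd (yIdx j) g) + gmul (pd (yIdx j) f) (pd (xIdx j) g)) := by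
  unfold pbr
  simp only [sgnF_par f hf, pd_smul, gmul_smul_left, Finset.smul_sum, smul_add]

lemma par_pbr {k : ℕ} {a b : ℕ} (f g : Lam (2 * k)) (hf : IsPar a f) (hg : IsPar b g) :
    IsPar (a + b) (pbr f g) := by
  rw [pbr_par f g hf]
  refine par_smul _ _ (par_sum _ _ fun j => ?_)
  have key : ∀ i i', IsPar (a + b) (gmul (pd i f) (pd i' g)) := by
    intro i i' S hS
    rw [par_gmul _ _ (par_pd i f hf) (par_pd i' g hg) S hS]
    ring
  exact par_add _ _ (key _ _) (key _ _)

lemma berez_add {n : ℕ} (f g : Lam n) : berez (f + g) = berez f + berez g := rfl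
lemma berez_smul {n : ℕ} (c : ℂ) (f : Lam n) : berez (c • f) = c * berez f := rfl
lemma berez_sum {n : ℕ} {ι : Type*} (s : Finset ι) (F : ι → Lam n) :
    berez (∑ j ∈ s, F j) = ∑ j ∈ s, berez (F j) := by simp [berez]

lemma invar {k : ℕ} {a b : ℕ} (f g h : Lam (2 * k)) (hf : IsPar a f) (hg : IsPar b g) :
    berez (gmul (pbr f g) h) = berez (gmul f (pbr g h)) := by
  rw [pbr_par f g hf, pbr_par g h hg]
  simp only [gmul_smul_left, gmul_smul_right, gmul_sum_left, gmul_sum_right, gmul_add_left,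
    gmul_add_right, berez_smul, berez_sum, berez_add, Finset.mul_sum]
  refine Finset.sum_congr rfl fun j _ => ?_
  have hne : xIdx j ≠ yIdx j := by
    intro h
    have h1 := congrArg Fin.val h
    have := j.2
    simp only [xIdx, yIdx] at h1
    omega
  rw [ibp _ _ f g h hf hg, ibp _ _ f g h hf hg, pd_anti _ _ hne, gmul_smul_left, gmul_smul_right,
    berez_smul, pow_add]
  have := neg_sq a
  linear_combination (-(-1 : ℂ) ^ b * (berez (gmul f (gmul (pd (yIdx j) g) (pd (xIdx j) h)))
    + berez (gmul f (gmul (pd (xIdx j) g) (pd (yIdx j) h))))) * this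

lemma cyc {k : ℕ} {a b c : ℕ} (f g h : Lam (2 * k)) (hf : IsPar a f) (hg : IsPar b g)
    (hh : IsPar c h) :
    berez (gmul (pbr f g) h) = (-1 : ℂ) ^ (a * (b + c)) * berez (gmul (pbr g h) f) := by
  rw [invar f g h hf hg, gmul_comm _ _ hf (par_pbr g h hg hh), berez_smul]

lemma cocyc_eq {n : ℕ} (x y : LoopLam n) :
    cocyc x y = x.sum fun m a => y.sum fun p b =>
      if m + p = 0 then (m : ℂ) * berez (gmul a b) else 0 := by
  unfold cocyc
  refine Finsupp.sum_congr fun m _ => ?_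
  rw [Finsupp.sum, Finset.sum_eq_single (-m)]
  · simp
  · intro p _ hp
    rw [if_neg]
    intro h; exact hp (by omega)
  · intro h
    rw [Finsupp.notMem_support_iff.mp h]
    simp [gmul_zero_right, berez]

lemma cocyc_pbr {k : ℕ} (x y z : LoopLam (2 * k)) :
    cocyc (pbrL x y) z = x.sum fun m a => y.sum fun p b => z.sum fun q c =>
      if m + p + q = 0 then ((m + p : ℤ) : ℂ) * berez (gmul (pbr a b) c) else 0 := by
  rw [cocyc_eq, pbrL]
  have h0 : ∀ m : ℤ, (z.sum fun p b =>
      if m + p = 0 then (m : ℂ) * berez (gmul 0 b) else 0) = 0 := by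
    intro m; simp [gmul_zero_left, berez]
  have h1 : ∀ (m : ℤ) (a b : Lam (2 * k)), (z.sum fun p c =>
      if m + p = 0 then (m : ℂ) * berez (gmul (a + b) c) else 0) = (z.sum fun p c =>
      if m + p = 0 then (m : ℂ) * berez (gmul a c) else 0) + (z.sum fun p c =>
      if m + p = 0 then (m : ℂ) * berez (gmul b c) else 0) := by
    intro m a b
    rw [← Finsupp.sum_add]
    refine Finsupp.sum_congr fun p _ => ?_
    rw [gmul_add_left, berez_add]
    split_ifs <;> ring
  rw [Finsupp.sum_sum_index h0 h1]
  refine Finsupp.sum_congr fun m _ => ?_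
  rw [Finsupp.sum_sum_index h0 h1]
  refine Finsupp.sum_congr fun p _ => ?_
  rw [Finsupp.sum_single_index (h0 _)]

end CocAux

/-- The map `c(t^m ⊗ f, t^n ⊗ g) = δ_{m+n,0} · m · ∫ fg vol(θ)` is a
2-cocycle on the loop Poisson superalgebra `po(0|2k)⁽¹⁾`: for homogeneous `x, y, z` one
has `c(x,y) = −(−1)^{p(x)p(y)} c(y,x)` and
`c({x,y},z) + (−1)^{p(x)(p(y)+p(z))} c({y,z},x) + (−1)^{p(z)(p(x)+p(y))} c({z,x},y) = 0`. -/
theorem cocyc_is_2cocycle (k : ℕ) (hk : 1 ≤ k) (dx dy dz : ℕ)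
    (x y z : LoopLam (2 * k)) (hx : IsHomogL dx x) (hy : IsHomogL dy y)
    (hz : IsHomogL dz z) :
    cocyc x y = -(-1 : ℂ) ^ (dx * dy) * cocyc y x ∧
    cocyc (pbrL x y) z + (-1 : ℂ) ^ (dx * (dy + dz)) * cocyc (pbrL y z) x +
      (-1 : ℂ) ^ (dz * (dx + dy)) * cocyc (pbrL z x) y = 0 := by
  have px : ∀ m, CocAux.IsPar dx (x m) := fun m S h => by rw [hx m S h]
  have py : ∀ m, CocAux.IsPar dy (y m) := fun m S h => by rw [hy m S h]
  have pz : ∀ m, CocAux.IsPar dz (z m) := fun m S h => by rw [hz m S h]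
  constructor
  · rw [CocAux.cocyc_eq, CocAux.cocyc_eq, Finsupp.sum_comm y x]
    simp only [Finsupp.sum, Finset.mul_sum]
    refine Finset.sum_congr rfl fun m _ => Finset.sum_congr rfl fun p _ => ?_
    rw [CocAux.gmul_comm _ _ (px m) (py p), CocAux.berez_smul, add_comm p m]
    split_ifs with h
    · obtain rfl : p = -m := by omega
      push_cast; ring
    · simp
  · rw [CocAux.cocyc_pbr, CocAux.cocyc_pbr, CocAux.cocyc_pbr]
    simp only [Finsupp.sum]
    have e1 : ∀ F : ℤ → ℤ → ℤ → ℂ, (∑ m ∈ y.support, ∑ p ∈ z.support, ∑ q ∈ x.support, F m p q)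
        = ∑ q ∈ x.support, ∑ m ∈ y.support, ∑ p ∈ z.support, F m p q := by
      intro F
      rw [Finset.sum_comm (s := x.support)]
      exact Finset.sum_congr rfl fun _ _ => Finset.sum_comm
    have e2 : ∀ F : ℤ → ℤ → ℤ → ℂ, (∑ m ∈ z.support, ∑ p ∈ x.support, ∑ q ∈ y.support, F m p q)
        = ∑ p ∈ x.support, ∑ q ∈ y.support, ∑ m ∈ z.support, F m p q := by
      intro F
      rw [Finset.sum_comm]
      exact Finset.sum_congr rfl fun _ _ => Finset.sum_comm
    rw [e1, e2]
    simp only [Finset.mul_sum, ← Finset.sum_add_distrib]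
    refine Finset.sum_eq_zero fun m _ => Finset.sum_eq_zero fun p _ =>
      Finset.sum_eq_zero fun q _ => ?_
    by_cases h : m + p + q = 0
    · rw [if_pos h, if_pos (by omega), if_pos (by omega)]
      have c1 := CocAux.cyc _ _ _ (px m) (py p) (pz q)
      have c2 := CocAux.cyc _ _ _ (pz q) (px m) (py p)
      have s1 := CocAux.neg_sq (dz * (dx + dy))
      have hq : (q : ℂ) = -m - p := by
        have : (m : ℂ) + p + q = 0 := by exact_mod_cast h
        linear_combination this
      push_cast
      rw [hq]
      linear_combination (m : ℂ) * c1 - ((-1 : ℂ) ^ (dz * (dx + dy)) * p) * c2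
        - p * berez (gmul (pbr (x m) (y p)) (z q)) * s1
    · rw [if_neg h, if_neg (by omega), if_neg (by omega)]
      simp
end
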